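/- arXiv:2010.01470 — 9 statements merged into one kernel-verified Lean document; each statement's English description precedes it below -/
import Mathlib

section
/- There exists a non-degenerate ranking problem such that every ranking policy π maximizing the overall utility U(π) over all ranking policies satisfies U(π|UG) = 0 for some user group UG, even though there exists a ranking policy π' with U(π'|UG) > 0 for every user group UG. -/
open Finset

/-- A ranking problem in a two-sided market: finite nonempty sets of items, intents,
user groups; a partition of the items into item groups; group proportions; per-group
intent distributions; a nonnegative relevance function; and a nonnegative exposure
function on positions with positive total exposure. -/
structure RankingProblem where
  Item : Type
  Intent : Type
  UserGrp : Type
  ItemGrp : Type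
  [itemFin : Fintype Item]
  [itemDec : DecidableEq Item]
  [intentFin : Fintype Intent]
  [userFin : Fintype UserGrp]
  [itemGrpFin : Fintype ItemGrp]
  [itemGrpDec : DecidableEq ItemGrp]
  [itemNe : Nonempty Item]
  [intentNe : Nonempty Intent]
  [userNe : Nonempty UserGrp]
  /-- group proportion of each user group -/
  ρ : UserGrp → ℝ
  ρ_nonneg : ∀ g, 0 ≤ ρ g
  ρ_sum : ∑ g, ρ g = 1
  /-- the item group of each item; this partitions the items, each group being nonempty -/
  grp : Item → ItemGrp
  grp_surj : Function.Surjective grp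
  /-- intent distribution of each user group -/
  intentDist : UserGrp → Intent → ℝ
  intentDist_nonneg : ∀ g i, 0 ≤ intentDist g i
  intentDist_sum : ∀ g, ∑ i, intentDist g i = 1
  /-- relevance of each item to each intent -/
  rel : Item → Intent → ℝ
  rel_nonneg : ∀ d i, 0 ≤ rel d i
  /-- exposure of each position -/
  expo : Fin (Fintype.card Item) → ℝ
  expo_nonneg : ∀ n, 0 ≤ expo n
  expo_sum_pos : 0 < ∑ n, expo n

attribute [instance] RankingProblem.itemFin RankingProblem.itemDec
  RankingProblem.intentFin RankingProblem.userFin RankingProblem.itemGrpFin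
  RankingProblem.itemGrpDec RankingProblem.itemNe RankingProblem.intentNe
  RankingProblem.userNe

namespace RankingProblem

variable (P : RankingProblem)

/-- A ranking is a bijection from items onto positions. -/
abbrev Ranking := P.Item ≃ Fin (Fintype.card P.Item)

/-- The overall intent distribution I_U(i) = Σ_UG ρ_UG · I_UG(i). -/
noncomputable def overallIntent (i : P.Intent) : ℝ := ∑ g, P.ρ g * P.intentDist g i

/-- Utility of a ranking for an intent: U(σ|i) = Σ_d e(σ(d))·r(d,i). -/
noncomputable def intentUtil (σ : P.Ranking) (i : P.Intent) : ℝ :=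
  ∑ d, P.expo (σ d) * P.rel d i

/-- A ranking policy: a (finitely supported) probability distribution over rankings. -/
def IsPolicy (π : P.Ranking → ℝ) : Prop := (∀ σ, 0 ≤ π σ) ∧ ∑ σ, π σ = 1

/-- Utility of a policy for a user group. -/
noncomputable def groupUtil (π : P.Ranking → ℝ) (g : P.UserGrp) : ℝ :=
  ∑ σ, π σ * ∑ i, P.intentDist g i * P.intentUtil σ i

/-- Overall utility of a policy. -/
noncomputable def utility (π : P.Ranking → ℝ) : ℝ := ∑ g, P.ρ g * P.groupUtil π g

/-- Utility of a policy for an item group. -/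
noncomputable def itemGroupUtil (π : P.Ranking → ℝ) (dg : P.ItemGrp) : ℝ :=
  ∑ σ, π σ * ∑ i, P.overallIntent i *
    ∑ d ∈ univ.filter (fun d => P.grp d = dg), P.expo (σ d) * P.rel d i

/-- Average exposure of an item group under a policy. -/
noncomputable def groupExposure (π : P.Ranking → ℝ) (dg : P.ItemGrp) : ℝ :=
  (∑ σ, π σ * ∑ d ∈ univ.filter (fun d => P.grp d = dg), P.expo (σ d)) /
    (univ.filter (fun d => P.grp d = dg)).card

/-- Expected relevance of an item to the whole user population. -/
noncomputable def expRel (d : P.Item) : ℝ := ∑ i, P.overallIntent i * P.rel d i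

/-- Non-degeneracy of a ranking problem. -/
def NonDegenerate : Prop :=
  (∀ g, 0 < P.ρ g) ∧ (∀ i, 0 < P.overallIntent i) ∧
    (∀ i, ∃ d, 0 < P.rel d i) ∧ (∀ dg, ∃ d, P.grp d = dg ∧ 0 < P.expRel d)

/-- The amount of intent covered by a ranking. -/
noncomputable def coverage (σ : P.Ranking) : ℝ :=
  ∑ i ∈ univ.filter (fun i => 0 < P.intentUtil σ i), P.overallIntent i

instance : Nonempty P.Ranking := ⟨Fintype.equivFin P.Item⟩

/-- The maximum amount of intent coverable by any ranking. -/
noncomputable def maxCoverage : ℝ := ⨆ σ : P.Ranking, P.coverage σ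

/-- Items are ranked by expected relevance within each item group under π. -/
def RankedByExpRel (π : P.Ranking → ℝ) : Prop :=
  ∀ σ, 0 < π σ → ∀ dm dn, P.grp dm = P.grp dn → P.expRel dn < P.expRel dm →
    P.expo (σ dn) ≤ P.expo (σ dm)

/-- User fairness of a policy with respect to a concave increasing function f. -/
noncomputable def userFairness (f : ℝ → ℝ) (π : P.Ranking → ℝ) : ℝ :=
  ∑ g, P.ρ g * f (P.groupUtil π g)

/-- Diversity of a single ranking with respect to a concave increasing function g. -/
noncomputable def rankDiversity (gf : ℝ → ℝ) (σ : P.Ranking) : ℝ :=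
  ∑ i, P.overallIntent i * gf (P.intentUtil σ i)

/-- Diversity of a policy. -/
noncomputable def diversity (gf : ℝ → ℝ) (π : P.Ranking → ℝ) : ℝ :=
  ∑ σ, π σ * P.rankDiversity gf σ

/-- π maximizes the overall utility over all ranking policies. -/
def MaxUtil (π : P.Ranking → ℝ) : Prop :=
  P.IsPolicy π ∧ ∀ π', P.IsPolicy π' → P.utility π' ≤ P.utility π

/-- π maximizes user fairness over all ranking policies. -/
def MaxUF (f : ℝ → ℝ) (π : P.Ranking → ℝ) : Prop :=
  P.IsPolicy π ∧ ∀ π', P.IsPolicy π' → P.userFairness f π' ≤ P.userFairness f π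

/-- π maximizes diversity over all ranking policies. -/
def MaxDiv (gf : ℝ → ℝ) (π : P.Ranking → ℝ) : Prop :=
  P.IsPolicy π ∧ ∀ π', P.IsPolicy π' → P.diversity gf π' ≤ P.diversity gf π

/-- π satisfies the disparate treatment constraints with merit function M. -/
def SatDT (M : P.ItemGrp → ℝ) (π : P.Ranking → ℝ) : Prop :=
  ∀ dg1 dg2, P.groupExposure π dg1 / M dg1 = P.groupExposure π dg2 / M dg2

/-- π maximizes overall utility among policies satisfying the disparate treatment
constraints with merit function M. -/
def MaxUtilDT (M : P.ItemGrp → ℝ) (π : P.Ranking → ℝ) : Prop :=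
  P.IsPolicy π ∧ P.SatDT M π ∧
    ∀ π', P.IsPolicy π' → P.SatDT M π' → P.utility π' ≤ P.utility π

/-- π dominates π' for the user groups. -/
def DominatesUsers (π π' : P.Ranking → ℝ) : Prop :=
  (∀ g, P.groupUtil π' g ≤ P.groupUtil π g) ∧ ∃ g, P.groupUtil π' g < P.groupUtil π g

/-- π is Pareto efficient for the user groups. -/
def ParetoUsers (π : P.Ranking → ℝ) : Prop :=
  ¬ ∃ π', P.IsPolicy π' ∧ P.DominatesUsers π' π

/-- σ dominates σ' for the intents. -/
def DominatesIntents (σ σ' : P.Ranking) : Prop :=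
  (∀ i, P.intentUtil σ' i ≤ P.intentUtil σ i) ∧ ∃ i, P.intentUtil σ' i < P.intentUtil σ i

/-- σ is Pareto efficient for the intents. -/
def ParetoIntents (σ : P.Ranking) : Prop := ¬ ∃ σ', P.DominatesIntents σ' σ

end RankingProblem

/-- Two items, two intents, two user groups with proportions 2/3 and 1/3; user group `g`
only has intent `g`, item `d` is only relevant to intent `d`, and only the first position
receives exposure. -/
noncomputable def exProblem : RankingProblem where
  Item := Fin 2
  Intent := Fin 2
  UserGrp := Fin 2
  ItemGrp := Unit
  ρ := fun g => if g = 0 then 2 / 3 else 1 / 3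
  ρ_nonneg := by intro g; split_ifs <;> norm_num
  ρ_sum := by simp [Fin.sum_univ_two]; norm_num
  grp := fun _ => ()
  grp_surj := fun _ => ⟨0, rfl⟩
  intentDist := fun g i => if g = i then 1 else 0
  intentDist_nonneg := by intro g i; split_ifs <;> norm_num
  intentDist_sum := by intro g; simp
  rel := fun d i => if d = i then 1 else 0
  rel_nonneg := by intro d i; split_ifs <;> norm_num
  expo := fun n => if n.val = 0 then 1 else 0
  expo_nonneg := by intro n; split_ifs <;> norm_num
  expo_sum_pos := by
    change (0 : ℝ) < ∑ n : Fin 2, if n.val = 0 then 1 else 0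
    simp [Fin.sum_univ_two]

/-- The group utility is the expected exposure of the group's item. -/
lemma exProblem_groupUtil (π : exProblem.Ranking → ℝ) (g : Fin 2) :
    exProblem.groupUtil π g = ∑ σ, π σ * exProblem.expo (σ g) := by
  unfold RankingProblem.groupUtil
  refine Finset.sum_congr rfl fun σ _ => ?_
  congr 1
  change ∑ i : Fin 2, (if g = i then (1 : ℝ) else 0) *
    (∑ d : Fin 2, exProblem.expo (σ d) * (if d = i then (1 : ℝ) else 0)) = _
  simp

lemma exProblem_utility (π : exProblem.Ranking → ℝ) :
    exProblem.utility π =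
      2 / 3 * exProblem.groupUtil π (0 : Fin 2) + 1 / 3 * exProblem.groupUtil π (1 : Fin 2) := by
  change ∑ g : Fin 2, (if g = 0 then (2 / 3 : ℝ) else 1 / 3) * exProblem.groupUtil π g = _
  simp [Fin.sum_univ_two]

lemma exProblem_total (σ : exProblem.Ranking) :
    exProblem.expo (σ (0 : Fin 2)) + exProblem.expo (σ (1 : Fin 2)) = 1 := by
  have h := Equiv.sum_comp σ exProblem.expo
  have h1 : ∑ d, exProblem.expo (σ d)
      = exProblem.expo (σ (0 : Fin 2)) + exProblem.expo (σ (1 : Fin 2)) :=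
    Fin.sum_univ_two (fun d : Fin 2 => exProblem.expo (σ d))
  have h2 : ∑ n, exProblem.expo n = 1 := by
    change (∑ n : Fin 2, if n.val = 0 then (1 : ℝ) else 0) = 1
    simp [Fin.sum_univ_two]
  rw [← h1, h, h2]

/-- Group utilities of a policy sum to one. -/
lemma exProblem_sum (π : exProblem.Ranking → ℝ) (hπ : exProblem.IsPolicy π) :
    exProblem.groupUtil π (0 : Fin 2) + exProblem.groupUtil π (1 : Fin 2) = 1 := by
  rw [exProblem_groupUtil, exProblem_groupUtil, ← Finset.sum_add_distrib, ← hπ.2]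
  refine Finset.sum_congr rfl fun σ _ => ?_
  rw [← mul_add, exProblem_total, mul_one]

lemma exProblem_nonneg (π : exProblem.Ranking → ℝ) (hπ : exProblem.IsPolicy π) (g : Fin 2) :
    0 ≤ exProblem.groupUtil π g := by
  rw [exProblem_groupUtil]
  exact Finset.sum_nonneg fun σ _ => mul_nonneg (hπ.1 σ) (exProblem.expo_nonneg _)

/-- The identity ranking. -/
noncomputable def exId : exProblem.Ranking := Equiv.refl (Fin 2)

/-- The swapped ranking. -/
noncomputable def exSwap : exProblem.Ranking :=
  (Equiv.swap (0 : Fin 2) 1 : Fin 2 ≃ Fin 2)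

/-- The policy playing the identity with probability `1 - t` and the swap with
probability `t`. -/
noncomputable def exPol (t : ℝ) : exProblem.Ranking → ℝ :=
  fun σ => (if σ = exId then 1 - t else 0) + (if σ = exSwap then t else 0)

lemma exPol_isPolicy (t : ℝ) (h0 : 0 ≤ t) (h1 : t ≤ 1) : exProblem.IsPolicy (exPol t) := by
  refine ⟨fun σ => ?_, ?_⟩
  · unfold exPol
    split_ifs <;> linarith
  · simp [exPol, Finset.sum_add_distrib]

lemma exPol_util (t : ℝ) (g : Fin 2) :
    exProblem.groupUtil (exPol t) g =
      (1 - t) * exProblem.expo (exId g) + t * exProblem.expo (exSwap g) := by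
  rw [exProblem_groupUtil]
  simp [exPol, add_mul, Finset.sum_add_distrib]

lemma exPol_util_zero (t : ℝ) : exProblem.groupUtil (exPol t) (0 : Fin 2) = 1 - t := by
  rw [exPol_util]
  have h1 : exProblem.expo (exId (0 : Fin 2)) = 1 := by
    change (if (0 : Fin 2).val = 0 then (1 : ℝ) else 0) = 1
    simp
  have h2 : exProblem.expo (exSwap (0 : Fin 2)) = 0 := by
    change (if (Equiv.swap (0 : Fin 2) 1 0).val = 0 then (1 : ℝ) else 0) = 0
    simp
  rw [h1, h2]; ring

/-- There exists a non-degenerate ranking problem such that every ranking policy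
maximizing overall utility gives zero utility to some user group, even though some
policy gives positive utility to every user group. -/
theorem stmt0 :
    ∃ P : RankingProblem, P.NonDegenerate ∧
      (∃ π' : P.Ranking → ℝ, P.IsPolicy π' ∧ ∀ g, 0 < P.groupUtil π' g) ∧
      (∀ π : P.Ranking → ℝ, P.MaxUtil π → ∃ g, P.groupUtil π g = 0) := by
  have hint : ∀ i : Fin 2, 0 < exProblem.overallIntent i := by
    intro i
    change 0 < ∑ g : Fin 2, (if g = 0 then (2 / 3 : ℝ) else 1 / 3) * (if g = i then 1 else 0)
    fin_cases i <;> simp [Fin.sum_univ_two]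
  refine ⟨exProblem, ⟨?_, hint, ?_, ?_⟩, ⟨exPol (1 / 2), ?_, ?_⟩, ?_⟩
  · have key : ∀ g : Fin 2, 0 < (if g = 0 then (2 / 3 : ℝ) else 1 / 3) := by
      intro g
      split_ifs <;> norm_num
    exact key
  · have key : ∀ i : Fin 2, ∃ d : Fin 2, (0 : ℝ) < (if d = i then (1 : ℝ) else 0) :=
      fun i => ⟨i, by simp⟩
    exact key
  · intro dg
    refine ⟨(0 : Fin 2), rfl, ?_⟩
    have h : exProblem.expRel (0 : Fin 2) = exProblem.overallIntent (0 : Fin 2) := by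
      change ∑ i : Fin 2, exProblem.overallIntent i * (if (0 : Fin 2) = i then (1 : ℝ) else 0) = _
      simp
    rw [h]
    exact hint 0
  · exact exPol_isPolicy _ (by norm_num) (by norm_num)
  · have h0 := exPol_util_zero (1 / 2)
    have hs := exProblem_sum _ (exPol_isPolicy (1 / 2) (by norm_num) (by norm_num))
    have key : ∀ g : Fin 2, 0 < exProblem.groupUtil (exPol (1 / 2)) g := by
      rw [Fin.forall_fin_two]
      constructor <;> linarith
    exact key
  · intro π hπ
    refine ⟨(1 : Fin 2), ?_⟩
    have hp := exPol_isPolicy 0 le_rfl zero_le_one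
    have hm := hπ.2 _ hp
    rw [exProblem_utility, exProblem_utility] at hm
    have h0 := exPol_util_zero 0
    have hs := exProblem_sum _ hp
    have hs' := exProblem_sum _ hπ.1
    have hn := exProblem_nonneg _ hπ.1 1
    linarith
end

section
/- For every non-degenerate ranking problem, there exists a strictly increasing concave function f : ℝ → ℝ such that every ranking policy π maximizing the user fairness UF(π) over all ranking policies satisfies U(π|UG) > 0 for every user group UG. -/
open Finset

namespace RankingProblem

theorem aux_intentUtil_nonneg (P : RankingProblem) (σ : P.Ranking) (i : P.Intent) :
    0 ≤ P.intentUtil σ i :=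
  Finset.sum_nonneg fun d _ => mul_nonneg (P.expo_nonneg _) (P.rel_nonneg d i)

/-- Utility of a ranking for a user group. -/
noncomputable def auxVal (P : RankingProblem) (σ : P.Ranking) (g : P.UserGrp) : ℝ :=
  ∑ i, P.intentDist g i * P.intentUtil σ i

theorem auxVal_nonneg (P : RankingProblem) (σ : P.Ranking) (g : P.UserGrp) :
    0 ≤ P.auxVal σ g :=
  Finset.sum_nonneg fun i _ =>
    mul_nonneg (P.intentDist_nonneg g i) (P.aux_intentUtil_nonneg σ i)

theorem auxVal_exists_pos (P : RankingProblem) (hP : P.NonDegenerate) (g : P.UserGrp) :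
    ∃ σ, 0 < P.auxVal σ g := by
  obtain ⟨-, -, h3, -⟩ := hP
  have hi : ∃ i ∈ (Finset.univ : Finset P.Intent), 0 < P.intentDist g i := by
    by_contra! hcon
    have h := Finset.sum_nonpos hcon
    rw [P.intentDist_sum g] at h
    linarith
  obtain ⟨i, -, hi⟩ := hi
  obtain ⟨d, hd⟩ := h3 i
  have hn : ∃ n ∈ (Finset.univ : Finset (Fin (Fintype.card P.Item))), 0 < P.expo n := by
    by_contra! hcon
    have h := Finset.sum_nonpos hcon
    linarith [P.expo_sum_pos]
  obtain ⟨n, -, hn⟩ := hn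
  let σ : P.Ranking :=
    (Fintype.equivFin P.Item).trans (Equiv.swap (Fintype.equivFin P.Item d) n)
  have hσ : σ d = n := by simp [σ]
  have hu : 0 < P.intentUtil σ i := by
    refine Finset.sum_pos' (fun d _ => mul_nonneg (P.expo_nonneg _) (P.rel_nonneg d i))
      ⟨d, Finset.mem_univ _, ?_⟩
    rw [hσ]; exact mul_pos hn hd
  exact ⟨σ, Finset.sum_pos' (fun i _ =>
    mul_nonneg (P.intentDist_nonneg g i) (P.aux_intentUtil_nonneg σ i))
      ⟨i, Finset.mem_univ _, mul_pos hi hu⟩⟩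

theorem aux_uniform (P : RankingProblem) (hP : P.NonDegenerate) :
    ∃ π, P.IsPolicy π ∧ ∀ g, 0 < P.groupUtil π g := by
  have hc : (0 : ℝ) < (Fintype.card P.Ranking : ℝ) := by
    exact_mod_cast Fintype.card_pos
  refine ⟨fun _ => (Fintype.card P.Ranking : ℝ)⁻¹, ⟨fun _ => by positivity, ?_⟩, fun g => ?_⟩
  · rw [Finset.sum_const, Finset.card_univ, nsmul_eq_mul, mul_inv_cancel₀ hc.ne']
  · obtain ⟨σ, hσ⟩ := P.auxVal_exists_pos hP g
    exact Finset.sum_pos' (fun τ _ => mul_nonneg (by positivity) (P.auxVal_nonneg τ g))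
      ⟨σ, Finset.mem_univ _, mul_pos (by positivity) hσ⟩

theorem aux_bound (P : RankingProblem) :
    ∃ M : ℝ, 0 ≤ M ∧ ∀ π, P.IsPolicy π → ∀ g, P.groupUtil π g ≤ M := by
  have h0 : ∀ g, 0 ≤ ∑ σ, P.auxVal σ g := fun g =>
    Finset.sum_nonneg fun σ _ => P.auxVal_nonneg σ g
  refine ⟨∑ g, ∑ σ, P.auxVal σ g, Finset.sum_nonneg fun g _ => h0 g, fun π hπ g => ?_⟩
  have h1 : P.groupUtil π g ≤ ∑ σ, P.auxVal σ g := by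
    refine Finset.sum_le_sum fun σ _ => mul_le_of_le_one_left (P.auxVal_nonneg σ g) ?_
    rw [← hπ.2]
    exact Finset.single_le_sum (fun τ _ => hπ.1 τ) (Finset.mem_univ σ)
  exact h1.trans (Finset.single_le_sum (f := fun g => ∑ σ, P.auxVal σ g)
    (fun g _ => h0 g) (Finset.mem_univ g))

end RankingProblem

/-- For every non-degenerate ranking problem there is a strictly increasing concave f
such that every policy maximizing user fairness gives positive utility to every user
group. -/
theorem stmt1 (P : RankingProblem) (hP : P.NonDegenerate) :
    ∃ f : ℝ → ℝ, StrictMono f ∧ ConcaveOn ℝ Set.univ f ∧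
      ∀ π : P.Ranking → ℝ, P.MaxUF f π → ∀ g, 0 < P.groupUtil π g := by
  classical
  obtain ⟨π₀, hπ₀, hpos⟩ := P.aux_uniform hP
  obtain ⟨M, hM, hb⟩ := P.aux_bound
  obtain ⟨g₀, hg₀⟩ := Finite.exists_min (fun g => P.groupUtil π₀ g)
  have hρ := hP.1
  obtain ⟨δ, hδ, hδle⟩ : ∃ δ : ℝ, 0 < δ ∧ ∀ g, δ ≤ P.groupUtil π₀ g :=
    ⟨_, hpos g₀, hg₀⟩
  have hterm : ∀ g, 0 ≤ M / (δ * P.ρ g) := fun g =>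
    div_nonneg hM (mul_pos hδ (hρ g)).le
  obtain ⟨K, hK1, hK⟩ : ∃ K : ℝ, 1 ≤ K ∧ ∀ g, M < P.ρ g * (K * δ) := by
    refine ⟨1 + ∑ g, M / (δ * P.ρ g), ?_, fun g => ?_⟩
    · have := Finset.sum_nonneg (fun g (_ : g ∈ Finset.univ) => hterm g)
      linarith
    · have h1 := Finset.single_le_sum (fun g _ => hterm g) (Finset.mem_univ g)
      have h2 : 0 < δ * P.ρ g := mul_pos hδ (hρ g)
      rw [div_le_iff₀ h2] at h1
      nlinarith
  have hK0 : 0 < K := by linarith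
  refine ⟨fun x => min (K * (x - δ)) (x - δ), ?_, ?_, ?_⟩
  · intro x y hxy
    have : K * (x - δ) < K * (y - δ) := mul_lt_mul_of_pos_left (by linarith) hK0
    exact min_lt_min this (by linarith)
  · refine ⟨convex_univ, fun x _ y _ a b ha hb hab => ?_⟩
    simp only [smul_eq_mul]
    have hb' : b = 1 - a := by linarith
    have e1 := mul_le_mul_of_nonneg_left (min_le_left (K * (x - δ)) (x - δ)) ha
    have e2 := mul_le_mul_of_nonneg_left (min_le_left (K * (y - δ)) (y - δ)) hb
    have e3 := mul_le_mul_of_nonneg_left (min_le_right (K * (x - δ)) (x - δ)) ha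
    have e4 := mul_le_mul_of_nonneg_left (min_le_right (K * (y - δ)) (y - δ)) hb
    apply le_min
    · refine (add_le_add e1 e2).trans (le_of_eq ?_)
      rw [hb']; ring
    · refine (add_le_add e3 e4).trans (le_of_eq ?_)
      rw [hb']; ring
  · intro π hmax g
    by_contra hg
    push Not at hg
    have hle := hmax.2 π₀ hπ₀
    have h0 : 0 ≤ P.userFairness (fun x => min (K * (x - δ)) (x - δ)) π₀ := by
      refine Finset.sum_nonneg fun h _ => mul_nonneg (hρ h).le ?_
      have := hδle h
      exact le_min (mul_nonneg hK0.le (by linarith)) (by linarith)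
    have h1 : P.userFairness (fun x => min (K * (x - δ)) (x - δ)) π ≤
        ∑ h, (P.ρ h * M - if h = g then P.ρ g * (K * δ) else 0) := by
      refine Finset.sum_le_sum fun h _ => ?_
      split_ifs with hh
      · subst hh
        rw [← mul_sub]
        refine mul_le_mul_of_nonneg_left ((min_le_left _ _).trans ?_) (hρ h).le
        nlinarith
      · rw [sub_zero]
        refine mul_le_mul_of_nonneg_left ((min_le_right _ _).trans ?_) (hρ h).le
        have := hb π hmax.1 h
        linarith
    rw [Finset.sum_sub_distrib, ← Finset.sum_mul, P.ρ_sum, Finset.sum_ite_eq'] at h1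
    simp only [Finset.mem_univ, if_true] at h1
    have := hK g
    linarith
end

section
/- For every non-degenerate ranking problem, under every ranking policy π maximizing the overall utility U(π) over all ranking policies, items are ranked by expected relevance within each item group. -/
open Finset

namespace RankingProblem

/-- Utility of a single ranking. -/
noncomputable def rankVal (P : RankingProblem) (σ : P.Ranking) : ℝ :=
  ∑ d, P.expo (σ d) * P.expRel d

theorem utility_eq (P : RankingProblem) (π : P.Ranking → ℝ) :
    P.utility π = ∑ σ, π σ * P.rankVal σ := by
  have h : ∀ σ : P.Ranking,
      P.rankVal σ = ∑ g, P.ρ g * ∑ i, P.intentDist g i * P.intentUtil σ i := by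
    intro σ
    have h1 : P.rankVal σ = ∑ i, P.overallIntent i * P.intentUtil σ i := by
      simp only [rankVal, expRel, intentUtil, Finset.mul_sum]
      rw [Finset.sum_comm]
      refine Finset.sum_congr rfl fun i _ => Finset.sum_congr rfl fun d _ => ?_
      ring
    rw [h1]
    simp only [overallIntent, Finset.sum_mul, Finset.mul_sum]
    rw [Finset.sum_comm]
    refine Finset.sum_congr rfl fun i _ => Finset.sum_congr rfl fun d _ => ?_
    ring
  simp only [utility, groupUtil, h]
  simp_rw [Finset.mul_sum (s := (Finset.univ : Finset P.Ranking)),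
    Finset.mul_sum (s := (Finset.univ : Finset P.UserGrp))]
  rw [Finset.sum_comm]
  refine Finset.sum_congr rfl fun i _ => Finset.sum_congr rfl fun d _ => ?_
  ring

theorem rankVal_swap (P : RankingProblem) (σ : P.Ranking) (a b : P.Item) (hab : a ≠ b) :
    P.rankVal ((Equiv.swap a b).trans σ) - P.rankVal σ =
      (P.expo (σ b) - P.expo (σ a)) * (P.expRel a - P.expRel b) := by
  unfold rankVal
  rw [← Finset.sum_sub_distrib]
  rw [Finset.sum_eq_add_of_mem a b (Finset.mem_univ _) (Finset.mem_univ _) hab]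
  · simp
    ring
  · intro c _ hc
    simp [Equiv.swap_apply_of_ne_of_ne hc.1 hc.2]

end RankingProblem

/-- Under every policy maximizing overall utility, items are ranked by expected
relevance within each item group. -/
theorem stmt7 (P : RankingProblem) (hP : P.NonDegenerate)
    (π : P.Ranking → ℝ) (hπ : P.MaxUtil π) : P.RankedByExpRel π := by
  intro σ hσ a b _ hR
  by_contra! hE
  have hab : a ≠ b := by
    rintro rfl
    exact lt_irrefl _ hR
  have hs := P.rankVal_swap σ a b hab
  have hpos : 0 < (P.expo (σ b) - P.expo (σ a)) * (P.expRel a - P.expRel b) :=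
    mul_pos (sub_pos.2 hE) (sub_pos.2 hR)
  set τ : P.Ranking := (Equiv.swap a b).trans σ with hτ
  obtain ⟨⟨h0, h1⟩, hmax⟩ := hπ
  have hpol : P.IsPolicy
      (fun s => π s + (if s = τ then π σ else 0) - (if s = σ then π σ else 0)) := by
    constructor
    · intro s
      have := h0 s
      by_cases hs1 : s = σ
      · subst hs1
        by_cases h2 : s = τ <;> simp [h2, h0]
      · by_cases h2 : s = τ
        · simp only [h2, if_true]
          have := h0 τ
          split_ifs <;> linarith
        · simp [hs1, h2, h0]
    · rw [Finset.sum_sub_distrib, Finset.sum_add_distrib]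
      simp [h1]
  have := hmax _ hpol
  rw [P.utility_eq, P.utility_eq] at this
  simp only [sub_mul, add_mul, Finset.sum_sub_distrib, Finset.sum_add_distrib, ite_mul,
    zero_mul, Finset.sum_ite_eq', Finset.sum_ite_eq, Finset.mem_univ, if_true] at this
  nlinarith
end

section
/- For every non-degenerate ranking problem, if a ranking policy π maximizes the overall utility U(π) over all ranking policies, then every ranking σ with π(σ) > 0 is Pareto efficient for the intents. -/
open Finset

/-- The overall utility is linear in the policy, with the coefficient of a ranking being its
expected utility under the overall intent distribution. -/
theorem utility_eq_sum_ranking (P : RankingProblem) (π : P.Ranking → ℝ) :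
    P.utility π = ∑ σ, π σ * ∑ i, P.overallIntent i * P.intentUtil σ i := by
  unfold RankingProblem.utility RankingProblem.groupUtil RankingProblem.overallIntent
  simp only [Finset.mul_sum, Finset.sum_mul]
  rw [Finset.sum_comm]
  refine Finset.sum_congr rfl fun σ _ => ?_
  rw [Finset.sum_comm]
  refine Finset.sum_congr rfl fun i _ => Finset.sum_congr rfl fun g _ => ?_
  ring

/-- Every ranking in the support of a utility-maximizing policy is Pareto efficient
for the intents. -/
theorem stmt8 (P : RankingProblem) (hP : P.NonDegenerate)
    (π : P.Ranking → ℝ) (hπ : P.MaxUtil π)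
    (σ : P.Ranking) (hσ : 0 < π σ) : P.ParetoIntents σ := by
  rintro ⟨σ', hle, i₀, hlt⟩
  obtain ⟨⟨hnn, hsum⟩, hmax⟩ := hπ
  obtain ⟨-, hI, -, -⟩ := hP
  have hV : ∑ i, P.overallIntent i * P.intentUtil σ i
      < ∑ i, P.overallIntent i * P.intentUtil σ' i := by
    apply Finset.sum_lt_sum
    · intro i _
      exact mul_le_mul_of_nonneg_left (hle i) (hI i).le
    · exact ⟨i₀, Finset.mem_univ _, mul_lt_mul_of_pos_left hlt (hI i₀)⟩
  have key := hmax (fun τ => π τ + (if τ = σ' then π σ else 0) - (if τ = σ then π σ else 0)) ?_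
  · rw [utility_eq_sum_ranking, utility_eq_sum_ranking] at key
    simp only [sub_mul, add_mul, ite_mul, zero_mul, Finset.sum_sub_distrib,
      Finset.sum_add_distrib, Finset.sum_ite_eq', Finset.sum_ite_eq, Finset.mem_univ,
      if_true] at key
    have := mul_lt_mul_of_pos_left hV hσ
    linarith
  · constructor
    · intro τ
      have h1 := hnn τ
      by_cases h : τ = σ
      · subst h
        simp only [if_true]
        split_ifs <;> linarith
      · simp only [h, if_false]
        split_ifs <;> linarith
    · simp only [Finset.sum_sub_distrib, Finset.sum_add_distrib, Finset.sum_ite_eq',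
        Finset.mem_univ, if_true, hsum]
      ring
end

section
/- For every non-degenerate ranking problem and every strictly increasing concave function f : ℝ → ℝ, if a ranking policy π maximizes the user fairness UF(π) over all ranking policies, then every ranking σ with π(σ) > 0 is Pareto efficient for the intents. -/
open Finset

/-- Every ranking in the support of a user-fairness-maximizing policy is Pareto
efficient for the intents. -/
theorem stmt10 (P : RankingProblem) (hP : P.NonDegenerate) (f : ℝ → ℝ)
    (hf : StrictMono f) (hf' : ConcaveOn ℝ Set.univ f)
    (π : P.Ranking → ℝ) (hπ : P.MaxUF f π)
    (σ : P.Ranking) (hσ : 0 < π σ) : P.ParetoIntents σ := by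
  rintro ⟨σ', hle, i₀, hlt⟩
  obtain ⟨hρ, hI, -, -⟩ := hP
  obtain ⟨⟨hnn, hsum⟩, hmax⟩ := hπ
  have hne : σ ≠ σ' := by
    rintro rfl
    exact lt_irrefl _ hlt
  obtain ⟨g₀, -, hg₀⟩ : ∃ g ∈ (univ : Finset P.UserGrp), 0 < P.ρ g * P.intentDist g i₀ := by
    apply Finset.exists_lt_of_sum_lt
    simpa [RankingProblem.overallIntent] using hI i₀
  have hg₀' : 0 < P.intentDist g₀ i₀ := pos_of_mul_pos_right hg₀ (hρ g₀).le
  let A : P.UserGrp → P.Ranking → ℝ := fun g τ => ∑ i, P.intentDist g i * P.intentUtil τ i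
  have hA : ∀ g, A g σ ≤ A g σ' := fun g => Finset.sum_le_sum fun i _ =>
    mul_le_mul_of_nonneg_left (hle i) (P.intentDist_nonneg g i)
  have hA₀ : A g₀ σ < A g₀ σ' := Finset.sum_lt_sum
    (fun i _ => mul_le_mul_of_nonneg_left (hle i) (P.intentDist_nonneg g₀ i))
    ⟨i₀, mem_univ _, mul_lt_mul_of_pos_left hlt hg₀'⟩
  let π' : P.Ranking → ℝ := fun τ =>
    π τ + ((if τ = σ' then π σ else 0) - (if τ = σ then π σ else 0))
  have hpol : P.IsPolicy π' := by
    constructor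
    · intro τ
      have h1 := hnn τ
      show 0 ≤ π τ + ((if τ = σ' then π σ else 0) - (if τ = σ then π σ else 0))
      by_cases h : τ = σ
      · subst h
        simp [hne]
      · by_cases h' : τ = σ' <;> simp [h, h'] <;> first | linarith | (rw [if_neg hne.symm]; linarith [hnn σ']) | linarith [hnn σ']
    · simp [π', Finset.sum_add_distrib, Finset.sum_sub_distrib, hsum]
  have hG : ∀ g, P.groupUtil π' g = P.groupUtil π g + π σ * (A g σ' - A g σ) := by
    intro g
    show ∑ τ, π' τ * A g τ = ∑ τ, π τ * A g τ + π σ * (A g σ' - A g σ)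
    simp [π', add_mul, sub_mul, Finset.sum_add_distrib, Finset.sum_sub_distrib, mul_sub]
  refine absurd (hmax π' hpol) (not_le.mpr ?_)
  unfold RankingProblem.userFairness
  apply Finset.sum_lt_sum
  · intro g _
    refine mul_le_mul_of_nonneg_left (hf.monotone ?_) (hρ g).le
    rw [hG]
    nlinarith [mul_nonneg hσ.le (sub_nonneg.mpr (hA g))]
  · refine ⟨g₀, mem_univ _, mul_lt_mul_of_pos_left (hf ?_) (hρ g₀)⟩
    rw [hG]
    nlinarith [mul_pos hσ (sub_pos.mpr hA₀)]
end

section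
/- For every non-degenerate ranking problem and every merit function M for which the disparate treatment constraints are satisfied by at least one ranking policy, under every ranking policy π that maximizes the overall utility U(π) among all policies satisfying the disparate treatment constraints, items are ranked by expected relevance within each item group. -/
open Finset

theorem aux_utility_eq (P : RankingProblem) (π : P.Ranking → ℝ) :
    P.utility π = ∑ σ, π σ * ∑ d, P.expo (σ d) * P.expRel d := by
  unfold RankingProblem.utility RankingProblem.groupUtil RankingProblem.expRel
    RankingProblem.overallIntent RankingProblem.intentUtil
  simp only [Finset.mul_sum, Finset.sum_mul]
  rw [Finset.sum_comm]
  refine Finset.sum_congr rfl fun σ _ => ?_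
  have h1 : ∀ g, (∑ i, ∑ d, P.ρ g * (π σ * (P.intentDist g i * (P.expo (σ d) * P.rel d i))))
      = ∑ d, ∑ i, P.ρ g * (π σ * (P.intentDist g i * (P.expo (σ d) * P.rel d i))) :=
    fun g => Finset.sum_comm
  simp only [h1]
  rw [Finset.sum_comm]
  refine Finset.sum_congr rfl fun d _ => ?_
  rw [Finset.sum_comm]
  refine Finset.sum_congr rfl fun i _ => ?_
  refine Finset.sum_congr rfl fun g _ => ?_
  ring

/-- Moving the mass of `σ` to `σ'`. -/
theorem aux_move {α : Type*} [Fintype α] [DecidableEq α] (π F : α → ℝ) (σ σ' : α) :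
    ∑ τ, (π τ + π σ * ((if τ = σ' then 1 else 0) - (if τ = σ then 1 else 0))) * F τ
      = ∑ τ, π τ * F τ + π σ * (F σ' - F σ) := by
  have h : ∀ τ, (π τ + π σ * ((if τ = σ' then 1 else 0) - (if τ = σ then 1 else 0))) * F τ
      = π τ * F τ + ((if τ = σ' then π σ * F τ else 0) - (if τ = σ then π σ * F τ else 0)) := by
    intro τ
    split_ifs <;> ring
  simp only [h, Finset.sum_add_distrib, Finset.sum_sub_distrib, Finset.sum_ite_eq',
    Finset.mem_univ, if_true]
  ring

/-- Under every policy maximizing utility subject to satisfiable disparate treatment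
constraints, items are ranked by expected relevance within each item group. -/
theorem stmt13 (P : RankingProblem) (hP : P.NonDegenerate)
    (M : P.ItemGrp → ℝ) (hM : ∀ dg, 0 < M dg)
    (hsat : ∃ π0 : P.Ranking → ℝ, P.IsPolicy π0 ∧ P.SatDT M π0)
    (π : P.Ranking → ℝ) (hπ : P.MaxUtilDT M π) : P.RankedByExpRel π := by
  intro σ hσ dm dn hg hr
  by_contra hlt
  have hlt := not_le.mp hlt
  obtain ⟨⟨hnn, hsum⟩, hdt, hmax⟩ := hπ
  have hne : dm ≠ dn := by
    rintro rfl
    exact lt_irrefl _ hr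
  set s : Equiv.Perm P.Item := Equiv.swap dm dn with hs
  set σ' : P.Ranking := s.trans σ with hσ'
  let π' : P.Ranking → ℝ := fun τ =>
    π τ + π σ * ((if τ = σ' then 1 else 0) - (if τ = σ then 1 else 0))
  have hpol : P.IsPolicy π' := by
    constructor
    · intro τ
      have ht := hnn τ
      have hs0 := hnn σ
      change 0 ≤ π τ + π σ * ((if τ = σ' then 1 else 0) - (if τ = σ then 1 else 0))
      by_cases h1 : τ = σ
      · rw [if_pos h1, h1]
        split_ifs <;> linarith
      · rw [if_neg h1]
        split_ifs <;> linarith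
    · have := aux_move π (fun _ => 1) σ σ'
      simp only [mul_one, sub_self, mul_zero, add_zero] at this
      exact this.trans hsum
  have hexp : ∀ dg, P.groupExposure π' dg = P.groupExposure π dg := by
    intro dg
    unfold RankingProblem.groupExposure
    congr 1
    rw [show (∑ τ, π' τ * ∑ d ∈ Finset.univ.filter (fun d => P.grp d = dg), P.expo (τ d)) = _ from
      aux_move π (fun τ => ∑ d ∈ Finset.univ.filter (fun d => P.grp d = dg), P.expo (τ d)) σ σ']
    have hgs : ∀ d, P.grp (s d) = P.grp d := by
      intro d
      rw [hs, Equiv.swap_apply_def]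
      split_ifs with h1 h2
      · rw [h1, hg]
      · rw [h2, hg]
      · rfl
    have : (∑ d ∈ Finset.univ.filter (fun d => P.grp d = dg), P.expo (σ' d))
        = ∑ d ∈ Finset.univ.filter (fun d => P.grp d = dg), P.expo (σ d) := by
      refine Finset.sum_equiv s ?_ ?_
      · intro d
        simp [hgs]
      · intro d _
        rfl
    rw [this]
    ring
  have hdt' : P.SatDT M π' := by
    intro a b
    rw [hexp, hexp]
    exact hdt a b
  have hle := hmax π' hpol hdt'
  rw [aux_utility_eq, aux_utility_eq,
    show (∑ τ, π' τ * ∑ d, P.expo (τ d) * P.expRel d) = _ from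
      aux_move π (fun τ => ∑ d, P.expo (τ d) * P.expRel d) σ σ'] at hle
  have hdiff : (∑ d, P.expo (σ' d) * P.expRel d) - ∑ d, P.expo (σ d) * P.expRel d
      = (P.expo (σ dn) - P.expo (σ dm)) * (P.expRel dm - P.expRel dn) := by
    rw [← Finset.sum_sub_distrib]
    rw [← Finset.sum_subset (Finset.subset_univ {dm, dn})]
    · rw [Finset.sum_pair hne]
      simp only [hσ', hs, Equiv.trans_apply, Equiv.swap_apply_left, Equiv.swap_apply_right]
      ring
    · intro d _ hd
      simp only [Finset.mem_insert, Finset.mem_singleton, not_or] at hd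
      simp only [hσ', hs, Equiv.trans_apply, Equiv.swap_apply_of_ne_of_ne hd.1 hd.2]
      ring
  simp only [hdiff] at hle
  have := mul_pos hσ (mul_pos (sub_pos.mpr hlt) (sub_pos.mpr hr))
  linarith
end

section
/- There exists a non-degenerate ranking problem and a merit function M for which the disparate treatment constraints are satisfied by at least one ranking policy, such that for every ranking policy π that maximizes the overall utility U(π) among all policies satisfying the disparate treatment constraints, there exists a ranking σ with π(σ) > 0 that is not Pareto efficient for the intents. -/
open Finset

/-- Two items in two groups, one intent, one user group; only the first position is seen. -/
noncomputable def exP : RankingProblem where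
  Item := Fin 2
  Intent := Unit
  UserGrp := Unit
  ItemGrp := Fin 2
  ρ := fun _ => 1
  ρ_nonneg := fun _ => zero_le_one
  ρ_sum := by simp
  grp := id
  grp_surj := Function.surjective_id
  intentDist := fun _ _ => 1
  intentDist_nonneg := fun _ _ => zero_le_one
  intentDist_sum := by simp
  rel := fun d _ => if d = 0 then 2 else 1
  rel_nonneg := by intro d i; split_ifs <;> norm_num
  expo := fun n => if n.val = 0 then 1 else 0
  expo_nonneg := by intro n; split_ifs <;> norm_num
  expo_sum_pos := by
    show 0 < ∑ n : Fin 2, (if n.val = 0 then (1 : ℝ) else 0)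
    simp [Fin.sum_univ_two]

/-- exposure of a position -/
noncomputable def exE (n : Fin 2) : ℝ := if n.val = 0 then 1 else 0

theorem exE_cases : ∀ σ : Fin 2 ≃ Fin 2,
    (exE (σ 0) = 1 ∧ exE (σ 1) = 0) ∨ (exE (σ 0) = 0 ∧ exE (σ 1) = 1) := by
  intro σ
  have h : σ 0 ≠ σ 1 := fun h => absurd (σ.injective h) (by decide)
  unfold exE
  generalize σ 0 = a at *
  generalize σ 1 = b at *
  fin_cases a <;> fin_cases b <;> simp_all

theorem exP_exposure (π : (Fin 2 ≃ Fin 2) → ℝ) (g : Fin 2) :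
    exP.groupExposure π g = ∑ σ : Fin 2 ≃ Fin 2, π σ * exE (σ g) := by
  have h : (univ.filter (fun d : Fin 2 => d = g)) = {g} := by ext; simp
  show (∑ σ : Fin 2 ≃ Fin 2, π σ * ∑ d ∈ univ.filter (fun d : Fin 2 => d = g), exE (σ d)) /
    ((univ.filter (fun d : Fin 2 => d = g)).card : ℝ) = _
  rw [h]
  simp

theorem exP_util (σ : Fin 2 ≃ Fin 2) (i : Unit) :
    exP.intentUtil σ i = 2 * exE (σ 0) + exE (σ 1) := by
  show ∑ d : Fin 2, exE (σ d) * (if d = 0 then (2 : ℝ) else 1) = _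
  rw [Fin.sum_univ_two]
  simp
  ring

theorem exP_overall (i : Unit) : exP.overallIntent i = 1 := by
  show ∑ _g : Unit, (1 : ℝ) * 1 = 1
  simp

theorem exP_expRel (d : Fin 2) : exP.expRel d = if d = 0 then 2 else 1 := by
  show ∑ i : Unit, exP.overallIntent i * (if d = 0 then (2 : ℝ) else 1) = _
  simp [exP_overall]

theorem stmt15 :
    ∃ (P : RankingProblem) (M : P.ItemGrp → ℝ), P.NonDegenerate ∧ (∀ dg, 0 < M dg) ∧
      (∃ π0 : P.Ranking → ℝ, P.IsPolicy π0 ∧ P.SatDT M π0) ∧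
      ∀ π : P.Ranking → ℝ, P.MaxUtilDT M π →
        ∃ σ, 0 < π σ ∧ ¬ P.ParetoIntents σ := by
  refine ⟨exP, fun _ => 1, ⟨?_, ?_, ?_, ?_⟩, fun _ => zero_lt_one, ?_, ?_⟩
  · intro g
    exact zero_lt_one
  · intro i
    rw [exP_overall i]
    exact zero_lt_one
  · intro i
    refine ⟨(0 : Fin 2), ?_⟩
    show (0 : ℝ) < if (0 : Fin 2) = 0 then 2 else 1
    simp
  · intro g
    refine ⟨g, rfl, ?_⟩
    rw [exP_expRel g]
    split_ifs <;> norm_num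
  · refine ⟨fun _ => 1 / (Fintype.card (Fin 2 ≃ Fin 2) : ℝ), ⟨?_, ?_⟩, ?_⟩
    · intro σ
      positivity
    · show ∑ _σ : Fin 2 ≃ Fin 2, 1 / (Fintype.card (Fin 2 ≃ Fin 2) : ℝ) = 1
      have : (Fintype.card (Fin 2 ≃ Fin 2) : ℝ) ≠ 0 := by
        exact_mod_cast Fintype.card_ne_zero
      rw [Finset.sum_const, Finset.card_univ, nsmul_eq_mul]
      field_simp
    · intro (g1 : Fin 2) (g2 : Fin 2)
      set c : ℝ := 1 / (Fintype.card (Fin 2 ≃ Fin 2) : ℝ) with hc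
      have e1 := exP_exposure (fun _ => c) g1
      have e2 := exP_exposure (fun _ => c) g2
      have e3 := Equiv.sum_comp (Equiv.mulRight (Equiv.swap g1 g2))
        (fun σ : Fin 2 ≃ Fin 2 => c * exE (σ g1))
      have e4 : ∑ σ : Fin 2 ≃ Fin 2, c * exE (σ g2) =
          ∑ σ : Fin 2 ≃ Fin 2, c * exE (σ g1) := by
        rw [← e3]
        simp
      exact congrArg (fun x : ℝ => x / 1) (e1.trans (e4.symm.trans e2.symm))
  · rintro (π : (Fin 2 ≃ Fin 2) → ℝ) ⟨⟨hn, hs⟩, hdt, -⟩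
    have hs' : ∑ σ : Fin 2 ≃ Fin 2, π σ = 1 := hs
    have h := hdt (0 : Fin 2) (1 : Fin 2)
    rw [exP_exposure π 0, exP_exposure π 1, div_one, div_one] at h
    have hsum : ∑ σ : Fin 2 ≃ Fin 2, π σ * exE (σ 0) +
        ∑ σ : Fin 2 ≃ Fin 2, π σ * exE (σ 1) = 1 := by
      rw [← Finset.sum_add_distrib, ← hs']
      refine Finset.sum_congr rfl fun σ _ => ?_
      rcases exE_cases σ with ⟨h0, h1⟩ | ⟨h0, h1⟩ <;> rw [h0, h1] <;> ring
    have hpos : 0 < ∑ σ : Fin 2 ≃ Fin 2, π σ * exE (σ 1) := by linarith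
    obtain ⟨σ, -, hσ⟩ := Finset.exists_lt_of_sum_lt
      (s := univ) (f := fun _ : Fin 2 ≃ Fin 2 => (0 : ℝ)) (by simpa using hpos)
    have hc := exE_cases σ
    rcases hc with ⟨h0, h1⟩ | ⟨h0, h1⟩
    · rw [h1] at hσ
      simp at hσ
    · rw [h1, mul_one] at hσ
      refine ⟨σ, hσ, fun hp => hp ⟨((Equiv.swap (0 : Fin 2) 1).trans σ : Fin 2 ≃ Fin 2), ?_⟩⟩
      let τ : Fin 2 ≃ Fin 2 := (Equiv.swap (0 : Fin 2) 1).trans σ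
      have key : ∀ i : Unit, exP.intentUtil σ i <
          exP.intentUtil τ i := by
        intro i
        have t0 : τ 0 = σ 1 := by simp [τ]
        have t1 : τ 1 = σ 0 := by simp [τ]
        rw [exP_util σ i, exP_util τ i, t0, t1, h0, h1]
        norm_num
      exact ⟨fun i => (key i).le, (), key ()⟩
end

section
/- For every non-degenerate ranking problem, there exists a strictly increasing concave function g : ℝ → ℝ such that for every ranking policy π maximizing the diversity D(π) over all ranking policies, every ranking σ with π(σ) > 0 covers the maximum coverable intent, i.e., the amount of intent covered by σ equals the maximum over all rankings of the amount of intent covered. -/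
open Finset

/-- For every non-degenerate ranking problem there is a strictly increasing concave g
such that every ranking in the support of a diversity-maximizing policy covers the
maximum coverable intent. -/
theorem stmt16 (P : RankingProblem) (hP : P.NonDegenerate) :
    ∃ g : ℝ → ℝ, StrictMono g ∧ ConcaveOn ℝ Set.univ g ∧
      ∀ π : P.Ranking → ℝ, P.MaxDiv g π →
        ∀ σ, 0 < π σ → P.coverage σ = P.maxCoverage := by
  obtain ⟨B, hB⟩ := (Set.finite_range
    (fun p : P.Ranking × P.Intent => (P.intentUtil p.1 p.2)⁻¹)).bddAbove
  have hδ : ∃ δ : ℝ, 0 < δ ∧ ∀ σ i, 0 < P.intentUtil σ i → δ ≤ P.intentUtil σ i := by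
    refine ⟨(max B 1)⁻¹, by positivity, fun σ i h => ?_⟩
    have h1 : (P.intentUtil σ i)⁻¹ ≤ max B 1 :=
      le_trans (hB ⟨(σ, i), rfl⟩) (le_max_left _ _)
    exact inv_le_of_inv_le₀ h h1
  obtain ⟨δ, hδ0, hδ⟩ := hδ
  let V : P.Ranking → ℝ := fun σ => ∑ i, P.overallIntent i * P.intentUtil σ i
  obtain ⟨C, hC⟩ := (Set.finite_range
    (fun p : P.Ranking × P.Ranking =>
      (V p.1 - V p.2) / (δ * (P.coverage p.2 - P.coverage p.1)))).bddAbove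
  obtain ⟨K, hK0, hKC⟩ : ∃ K : ℝ, 0 ≤ K ∧ C < K :=
    ⟨max 0 (C + 1), le_max_left _ _, lt_of_lt_of_le (lt_add_one C) (le_max_right _ _)⟩
  have hU0 : ∀ σ i, 0 ≤ P.intentUtil σ i := fun σ i =>
    Finset.sum_nonneg fun d _ => mul_nonneg (P.expo_nonneg _) (P.rel_nonneg _ _)
  let g : ℝ → ℝ := fun x => x + K * min x δ
  have hD : ∀ σ, P.rankDiversity g σ = V σ + K * δ * P.coverage σ := by
    intro σ
    simp only [RankingProblem.rankDiversity, RankingProblem.coverage, V, g]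
    rw [Finset.sum_filter, Finset.mul_sum, ← Finset.sum_add_distrib]
    refine Finset.sum_congr rfl fun i _ => ?_
    split_ifs with h
    · rw [min_eq_right (hδ σ i h)]; ring
    · have h0 : P.intentUtil σ i = 0 := le_antisymm (not_lt.mp h) (hU0 σ i)
      rw [h0, min_eq_left hδ0.le]; ring
  have hlt : ∀ σ σ', P.coverage σ < P.coverage σ' →
      P.rankDiversity g σ < P.rankDiversity g σ' := by
    intro σ σ' h
    have hpos : 0 < δ * (P.coverage σ' - P.coverage σ) := mul_pos hδ0 (sub_pos.mpr h)
    have h1 : (V σ - V σ') / (δ * (P.coverage σ' - P.coverage σ)) < K :=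
      lt_of_le_of_lt (hC ⟨(σ, σ'), rfl⟩) hKC
    rw [div_lt_iff₀ hpos] at h1
    rw [hD, hD]
    linarith
  refine ⟨g, ?_, ?_, ?_⟩
  · intro x y h
    have : min x δ ≤ min y δ := min_le_min_right _ h.le
    have := mul_le_mul_of_nonneg_left this hK0
    simp only [g]; linarith
  · have h1 : ConcaveOn ℝ Set.univ (fun x : ℝ => x) := concaveOn_id convex_univ
    have h2 : ConcaveOn ℝ Set.univ (fun _ : ℝ => δ) := concaveOn_const δ convex_univ
    exact h1.add ((h1.inf h2).smul hK0)
  · intro π hπ σ hσ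
    obtain ⟨⟨hπ0, hπ1⟩, hmax⟩ := hπ
    have hbdd : BddAbove (Set.range P.coverage) := (Set.finite_range _).bddAbove
    refine le_antisymm (le_ciSup hbdd σ) (ciSup_le fun σ' => ?_)
    by_contra! hcov
    have hdiv := hlt σ σ' hcov
    obtain ⟨τ, hτ⟩ := Finite.exists_max (P.rankDiversity g)
    have hpol : P.IsPolicy (fun s => if s = τ then 1 else 0) :=
      ⟨fun s => by dsimp only; split_ifs <;> norm_num, by simp⟩
    have h1 := hmax _ hpol
    simp only [RankingProblem.diversity, ite_mul, one_mul, zero_mul, Finset.sum_ite_eq',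
      Finset.mem_univ, if_true] at h1
    have h2 : ∑ s, π s * P.rankDiversity g s < ∑ s, π s * P.rankDiversity g τ :=
      Finset.sum_lt_sum (fun s _ => mul_le_mul_of_nonneg_left (hτ s) (hπ0 s))
        ⟨σ, Finset.mem_univ _, mul_lt_mul_of_pos_left (lt_of_lt_of_le hdiv (hτ σ')) hσ⟩
    rw [← Finset.sum_mul, hπ1, one_mul] at h2
    linarith
end

section
/- There exists a non-degenerate ranking problem such that for every strictly increasing concave function g : ℝ → ℝ, every ranking policy π maximizing the diversity D(π) over all ranking policies satisfies U(π|DG) = 0 for some item group DG. -/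
open Finset

/-- Two items, one intent, one user group; each item is its own group; only the first
position gets exposure; item `true` is more relevant than item `false`. -/
noncomputable def witnessProblem : RankingProblem where
  Item := Bool
  Intent := Unit
  UserGrp := Unit
  ItemGrp := Bool
  ρ := fun _ => 1
  ρ_nonneg := fun _ => zero_le_one
  ρ_sum := by simp
  grp := id
  grp_surj := Function.surjective_id
  intentDist := fun _ _ => 1
  intentDist_nonneg := fun _ _ => zero_le_one
  intentDist_sum := by simp
  rel := fun d _ => if d then 2 else 1
  rel_nonneg := by intro d _; cases d <;> norm_num
  expo := fun n => if n.val = 0 then 1 else 0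
  expo_nonneg := by intro n; split_ifs <;> norm_num
  expo_sum_pos := by
    apply Finset.sum_pos'
    · intro n _; split_ifs <;> norm_num
    · exact ⟨⟨0, by simp⟩, Finset.mem_univ _, by simp⟩

lemma witness_overall (i : witnessProblem.Intent) : witnessProblem.overallIntent i = 1 := by
  change ∑ g : Unit, (1 : ℝ) * 1 = 1
  simp

lemma witness_util (σ : Bool ≃ Fin (Fintype.card Bool)) (i : Unit) :
    witnessProblem.intentUtil σ i = if (σ true).val = 0 then 2 else 1 := by
  change ∑ d : Bool, (if (σ d).val = 0 then (1 : ℝ) else 0) * (if d then 2 else 1) = _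
  have hne : (σ true).val ≠ (σ false).val := fun h => by
    have := σ.injective (Fin.ext h)
    simp at this
  have h1 : (σ true).val < 2 := (σ true).isLt
  have h2 : (σ false).val < 2 := (σ false).isLt
  rw [Fintype.sum_bool]
  by_cases h : (σ true).val = 0
  · have h' : (σ false).val ≠ 0 := by omega
    rw [if_pos h, if_neg h', if_pos h]
    norm_num
  · have h' : (σ false).val = 0 := by omega
    rw [if_neg h, if_pos h', if_neg h]
    norm_num

lemma witness_div (g : ℝ → ℝ) (σ : Bool ≃ Fin (Fintype.card Bool)) :
    witnessProblem.rankDiversity g σ = g (if (σ true).val = 0 then 2 else 1) := by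
  have h : ∀ i : Unit, witnessProblem.overallIntent i * g (witnessProblem.intentUtil σ i)
      = g (if (σ true).val = 0 then 2 else 1) := fun i =>
    (congrArg₂ (fun a b => a * g b) (witness_overall i) (witness_util σ i)).trans (one_mul _)
  exact (Fintype.sum_unique (ι := Unit) _).trans (h _)

theorem stmt18 :
    ∃ P : RankingProblem, P.NonDegenerate ∧
      ∀ g : ℝ → ℝ, StrictMono g → ConcaveOn ℝ Set.univ g →
        ∀ π : P.Ranking → ℝ, P.MaxDiv g π → ∃ dg, P.itemGroupUtil π dg = 0 := by
  refine ⟨witnessProblem, ⟨fun _ => zero_lt_one, fun i => ?_, fun i => ⟨true, ?_⟩,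
    fun dg => ⟨dg, rfl, ?_⟩⟩, ?_⟩
  · rw [witness_overall]; exact zero_lt_one
  · change (0 : ℝ) < if true then 2 else 1
    norm_num
  · refine Finset.sum_pos (fun i _ => mul_pos ?_ ?_) Finset.univ_nonempty
    · rw [witness_overall]; exact zero_lt_one
    · have h : ∀ b : Bool, (0 : ℝ) < if b then 2 else 1 := by
        intro b; cases b <;> norm_num
      exact h dg
  intro g hg _ π hπ
  obtain ⟨⟨hpos, hsum⟩, hmax⟩ := hπ
  obtain ⟨σ₀, hσ₀⟩ : ∃ σ₀ : witnessProblem.Ranking, (σ₀ true).val = 0 := by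
    let τ : witnessProblem.Ranking := Fintype.equivFin witnessProblem.Item
    let z : Fin (Fintype.card witnessProblem.Item) := ⟨0, Fintype.card_pos⟩
    refine ⟨τ.trans (Equiv.swap (τ true) z), ?_⟩
    exact congrArg Fin.val (Equiv.swap_apply_left (τ true) z)
  have hle : ∀ σ : witnessProblem.Ranking, witnessProblem.rankDiversity g σ ≤ g 2 := by
    intro σ
    refine (witness_div g σ).trans_le ?_
    apply hg.monotone
    split_ifs <;> norm_num
  have key : g 2 ≤ witnessProblem.diversity g π := by
    classical
    have h := hmax (fun σ => if σ = σ₀ then 1 else 0)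
      ⟨fun σ => by dsimp only; split_ifs <;> norm_num, by simp⟩
    have e : witnessProblem.diversity g (fun σ => if σ = σ₀ then 1 else 0) = g 2 := by
      unfold RankingProblem.diversity
      simp only [ite_mul, one_mul, zero_mul, Finset.sum_ite_eq', Finset.mem_univ, if_true]
      exact (witness_div g σ₀).trans (congrArg g (if_pos hσ₀))
    rwa [e] at h
  have hnn : ∀ σ ∈ (Finset.univ : Finset witnessProblem.Ranking),
      0 ≤ π σ * (g 2 - witnessProblem.rankDiversity g σ) := fun σ _ =>
    mul_nonneg (hpos σ) (sub_nonneg.2 (hle σ))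
  have hz : ∑ σ, π σ * (g 2 - witnessProblem.rankDiversity g σ) = 0 := by
    apply le_antisymm _ (Finset.sum_nonneg hnn)
    simp only [mul_sub, Finset.sum_sub_distrib]
    rw [← Finset.sum_mul, hsum, one_mul]
    exact sub_nonpos.2 key
  have hall := (Finset.sum_eq_zero_iff_of_nonneg hnn).1 hz
  obtain ⟨dg, hdg⟩ : ∃ x : witnessProblem.ItemGrp, x = false := ⟨false, rfl⟩
  refine ⟨dg, ?_⟩
  unfold RankingProblem.itemGroupUtil
  refine Finset.sum_eq_zero fun σ hσ => ?_
  rcases mul_eq_zero.1 (hall σ hσ) with h | h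
  · rw [h, zero_mul]
  · have h0 : (σ true).val = 0 := by
      by_contra hne
      have h2 := (witness_div g σ).trans (congrArg g (if_neg hne))
      have := hg (show (1 : ℝ) < 2 by norm_num)
      linarith
    refine mul_eq_zero_of_right _ (Finset.sum_eq_zero fun i _ => mul_eq_zero_of_right _
      (Finset.sum_eq_zero fun d hd => mul_eq_zero_of_left ?_ _))
    have hd' : d = false := by
      rw [Finset.mem_filter] at hd
      exact hd.2.trans hdg
    subst hd'
    change (if (σ false).val = 0 then (1 : ℝ) else 0) = 0
    rw [if_neg]
    intro h1
    have := σ.injective (Fin.ext (h0.trans h1.symm))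
    exact absurd this Bool.true_eq_false_eq_False
end
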